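/- arXiv:2008.03267 — 2 statements merged into one kernel-verified Lean document; each statement's English description precedes it below -/
import Mathlib

section
/- Let G be a finite gyrogroup and let s ∈ G be an element with s = ⊖s and s ≠ e. Then the left Cayley graph LCay(G,{s}) is vertex-transitive: for any two vertices u, v ∈ G there exists a bijection φ : G → G with φ(u) = v such that for all x, y ∈ G, y is adjacent to x in LCay(G,{s}) if and only if φ(y) is adjacent to φ(x). -/
/-- A gyrogroup: a set `G` with a binary operation `add` (⊕), an identity `e`,
an inverse operation `neg` (⊖), and for each pair `a b : G` a gyroautomorphism
`gyr a b : G → G`, satisfying the gyrogroup axioms. -/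
class Gyrogroup (G : Type*) where
  add : G → G → G
  e : G
  neg : G → G
  gyr : G → G → G → G
  e_add : ∀ x, add e x = x
  add_e : ∀ x, add x e = x
  neg_add : ∀ x, add (neg x) x = e
  add_neg : ∀ x, add x (neg x) = e
  gyr_bijective : ∀ a b, Function.Bijective (gyr a b)
  gyr_add : ∀ a b x y, gyr a b (add x y) = add (gyr a b x) (gyr a b y)
  left_gyroassoc : ∀ a b c, add a (add b c) = add (add a b) (gyr a b c)
  left_loop : ∀ a b, gyr (add a b) b = gyr a b

open Gyrogroup


namespace Gyrogroup

variable {G : Type*} [Gyrogroup G]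

theorem neg_add_add (a b : G) : add (neg a) (add a b) = gyr (neg a) a b := by
  rw [left_gyroassoc, neg_add, e_add]

theorem add_left_injective (a : G) : Function.Injective (add a) := fun b c h =>
  (gyr_bijective (neg a) a).1 (by rw [← neg_add_add, ← neg_add_add, h])

theorem gyr_e_left (a c : G) : gyr e a c = c := by
  apply add_left_injective a
  have h := left_gyroassoc e a c
  rw [e_add, e_add] at h
  exact h.symm

theorem neg_add_cancel_left (a b : G) : add (neg a) (add a b) = b := by
  rw [neg_add_add, ← left_loop, neg_add, gyr_e_left]

theorem eq_add_gyr_neg (x a : G) : x = add (add x a) (gyr (add x a) a (neg a)) := by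
  rw [left_loop, ← left_gyroassoc, add_neg, add_e]

theorem add_right_injective (a : G) : Function.Injective fun x => add x a := by
  intro x y h
  change add x a = add y a at h
  rw [eq_add_gyr_neg x a, h, ← eq_add_gyr_neg]

end Gyrogroup

/-- The centralizer of a fixed-point-free involution acts transitively. -/
theorem Function.Involutive.exists_bijective_commute {α : Type*} {f : α → α}
    (hf : Function.Involutive f) (hne : ∀ x, f x ≠ x) (u v : α) :
    ∃ φ : α → α, Function.Bijective φ ∧ φ u = v ∧ ∀ x, φ (f x) = f (φ x) := by
  classical
  by_cases h : v = f u
  · exact ⟨f, hf.bijective, h.symm, fun _ => rfl⟩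
  · refine ⟨fun x => Equiv.swap u v (Equiv.swap (f u) (f v) x),
      (Equiv.bijective _).comp (Equiv.bijective _), ?_, fun x => ?_⟩
    · have h1 : u ≠ f u := (hne u).symm
      have h2 : u ≠ f v := fun h' => h (by rw [h', hf])
      simp [Equiv.swap_apply_of_ne_of_ne h1 h2]
    · have := hf u
      have := hf v
      have := hf x
      have := hne u
      have := hne v
      simp only [Equiv.swap_apply_def]
      grind

/-- If `G` is a finite gyrogroup and `s = ⊖s`, `s ≠ e`, then the left Cayley
graph `LCay(G,{s})` is vertex-transitive. -/
theorem lcay_singleton_involution_transitive {G : Type*} [Gyrogroup G] [Finite G]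
    (s : G) (hs : s = neg s) (hse : s ≠ e) :
    ∀ u v : G, ∃ φ : G → G, Function.Bijective φ ∧ φ u = v ∧
      ∀ x y : G, (∃ t ∈ ({s} : Set G), y = add t x) ↔
        (∃ t ∈ ({s} : Set G), φ y = add t (φ x)) := by
  have hinv : Function.Involutive (add s) := fun x => by
    have h := neg_add_cancel_left s x
    rwa [← hs] at h
  have hne : ∀ x, add s x ≠ x := fun x h =>
    hse (add_right_injective x (h.trans (e_add x).symm))
  intro u v
  obtain ⟨φ, hφ, huv, hcomm⟩ := hinv.exists_bijective_commute hne u v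
  refine ⟨φ, hφ, huv, fun x y => ?_⟩
  simp only [Set.mem_singleton_iff, exists_eq_left]
  rw [← hcomm, hφ.1.eq_iff]
end

section
/- Let G be a gyrogroup and let S ⊆ G be a symmetric subset with e ∉ S. If the right Cayley graph RCay(G,S) is undirected (for all u, v ∈ G, the existence of s ∈ S with v = u ⊕ s implies the existence of s' ∈ S with u = v ⊕ s'), then gyr[g,s]s ∈ S for all g ∈ G and all s ∈ S. -/
open Gyrogroup


namespace Gyrogroup

variable {G : Type*} [Gyrogroup G]

theorem add_left_cancel {a b c : G} (h : add a b = add a c) : b = c := by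
  apply (gyr_bijective (neg a) a).injective
  rw [← e_add (gyr (neg a) a b), ← e_add (gyr (neg a) a c), ← neg_add a,
    ← left_gyroassoc, ← left_gyroassoc, h]

theorem neg_neg (a : G) : neg (neg a) = a :=
  add_left_cancel (a := neg a) (by rw [add_neg, neg_add])

theorem gyr_e (a b : G) : gyr a b e = e :=
  add_left_cancel (a := gyr a b e) (by rw [← gyr_add, e_add, add_e])

theorem gyr_neg (a b x : G) : gyr a b (neg x) = neg (gyr a b x) :=
  add_left_cancel (a := gyr a b x) (by rw [← gyr_add, add_neg, add_neg, gyr_e])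

theorem add_add_neg_gyr (a b : G) : add (add a b) (neg (gyr a b b)) = a := by
  rw [← gyr_neg, ← left_gyroassoc, add_neg, add_e]

end Gyrogroup

/-- If `S` is symmetric, `e ∉ S`, and the right Cayley graph `RCay(G,S)` is
undirected, then `gyr g s s ∈ S` for all `g ∈ G` and `s ∈ S`. -/
theorem gyr_mem_of_rcay_undirected {G : Type*} [Gyrogroup G] (S : Set G)
    (hsym : ∀ s ∈ S, neg s ∈ S) (he : (e : G) ∉ S)
    (hund : ∀ u v : G, (∃ s ∈ S, v = add u s) → ∃ s' ∈ S, u = add v s') :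
    ∀ g : G, ∀ s ∈ S, gyr g s s ∈ S := by
  intro g s hs
  obtain ⟨s', hs', h⟩ := hund g (add g s) ⟨s, hs, rfl⟩
  have hneg : neg (gyr g s s) = s' :=
    add_left_cancel ((add_add_neg_gyr g s).trans h)
  rw [← neg_neg (gyr g s s), hneg]
  exact hsym s' hs'
end
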